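/- For r > 0 let χ_r denote a chi-distributed random variable with r degrees of freedom, i.e., with density (2^{1−r/2}/Γ(r/2)) x^{r−1} e^{−x²/2} on (0,∞). Then the mean of log(χ_r/√r) equals (1/2)(Γ'(r/2)/Γ(r/2) − log(r/2)) and the variance of log(χ_r/√r) equals (1/4)(Γ(r/2)Γ''(r/2) − Γ'(r/2)²)/Γ(r/2)². Moreover, there exists a constant C > 0 such that for all r ≥ 1 the mean satisfies |E[log(χ_r/√r)]| ≤ C/r, and the standard deviation satisfies | (Var[log(χ_r/√r)])^{1/2} − 1/√(2r) | ≤ C·r^{−3/2}. -/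

import Mathlib

open Real MeasureTheory

noncomputable section

/-- Density of the chi distribution with `r` degrees of freedom:
`(2^{1−r/2}/Γ(r/2)) x^{r−1} e^{−x²/2}` on `(0,∞)`. -/
def chiPDF (r x : ℝ) : ℝ :=
  (2 : ℝ) ^ (1 - r / 2) / Real.Gamma (r / 2) * x ^ (r - 1) * Real.exp (-x ^ 2 / 2)

/-- Mean of `log(χ_r/√r)` for a chi-distributed `χ_r`. -/
def chiLogMean (r : ℝ) : ℝ :=
  ∫ x in Set.Ioi (0 : ℝ), Real.log (x / Real.sqrt r) * chiPDF r x

/-- Variance of `log(χ_r/√r)` for a chi-distributed `χ_r`. -/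
def chiLogVar (r : ℝ) : ℝ :=
  (∫ x in Set.Ioi (0 : ℝ), (Real.log (x / Real.sqrt r)) ^ 2 * chiPDF r x) - (chiLogMean r) ^ 2

open Set Filter Topology Asymptotics in
/-- The Mellin transform of `log t ^ k * exp (-t)` converges on `0 < re s` and may be
differentiated under the integral sign there. -/
theorem mellin_log_pow_mul_exp_neg (k : ℕ) {s : ℂ} (hs : 0 < s.re) :
    MellinConvergent (fun t : ℝ => ((log t ^ k * exp (-t) : ℝ) : ℂ)) s ∧
      HasDerivAt (mellin fun t : ℝ => ((log t ^ k * exp (-t) : ℝ) : ℂ))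
        (mellin (fun t : ℝ => ((log t ^ (k + 1) * exp (-t) : ℝ) : ℂ)) s) s := by
  have hc : LocallyIntegrableOn (fun t : ℝ => ((log t ^ k * exp (-t) : ℝ) : ℂ)) (Ioi 0) := by
    refine ContinuousOn.locallyIntegrableOn ?_ measurableSet_Ioi
    refine Complex.continuous_ofReal.comp_continuousOn ?_
    exact ((continuousOn_log.mono fun t ht => (ne_of_gt ht)).pow k).mul (by fun_prop)
  have htop : (fun t : ℝ => ((log t ^ k * exp (-t) : ℝ) : ℂ)) =O[atTop]
      (· ^ (-(s.re + 1)) : ℝ → ℝ) := by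
    rw [Complex.isBigO_ofReal_left]
    have h := (isLittleO_pow_log_id_atTop (n := k)).isBigO.mul
      (isLittleO_exp_neg_mul_rpow_atTop zero_lt_one (-(s.re + 1) - 1)).isBigO
    refine h.congr' (by simp) ?_
    filter_upwards [eventually_gt_atTop 0] with t ht
    rw [rpow_sub_one ht.ne', id]
    field_simp
  have hbot : (fun t : ℝ => ((log t ^ k * exp (-t) : ℝ) : ℂ)) =O[𝓝[>] 0]
      (· ^ (-(s.re / 2)) : ℝ → ℝ) := by
    rw [Complex.isBigO_ofReal_left]
    have h1 : (fun t : ℝ => log t ^ k) =O[𝓝[>] 0] fun t : ℝ => t ^ (-(s.re / 2)) := by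
      have := (isLittleO_abs_log_rpow_rpow_nhdsGT_zero (s := -(s.re / 2)) k
        (by linarith)).isBigO.norm_left
      refine IsBigO.of_norm_left (this.congr_left fun t => ?_)
      simp
    have h2 : (fun t : ℝ => exp (-t)) =O[𝓝[>] 0] fun _ => (1 : ℝ) := by
      refine Tendsto.isBigO_one ℝ (c := exp (-0)) ?_
      exact (by fun_prop : Continuous fun t : ℝ => exp (-t)).continuousWithinAt
    simpa using h1.mul h2
  refine ⟨mellinConvergent_of_isBigO_rpow hc htop (lt_add_one _) hbot (by linarith), ?_⟩
  refine (mellin_hasDerivAt_of_isBigO_rpow hc htop (lt_add_one _) hbot (by linarith)).2.congr_deriv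
    (congrArg (mellin · s) (funext fun t => ?_))
  rw [Complex.real_smul, ← Complex.ofReal_mul, pow_succ', mul_assoc]

/-- The integral `∫ t ^ (s - 1) log t ^ k exp (-t)` over `(0, ∞)`. -/
def gammaLogMoment (k : ℕ) (s : ℝ) : ℝ :=
  ∫ t in Set.Ioi (0 : ℝ), t ^ (s - 1) * (log t ^ k * exp (-t))

theorem cpow_smul_log_pow_mul_exp_neg (k : ℕ) (s : ℝ) {t : ℝ} (ht : 0 < t) :
    (t : ℂ) ^ ((s : ℂ) - 1) • ((log t ^ k * exp (-t) : ℝ) : ℂ) =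
      ((t ^ (s - 1) * (log t ^ k * exp (-t)) : ℝ) : ℂ) := by
  rw [smul_eq_mul, Complex.ofReal_mul (t ^ (s - 1)), Complex.ofReal_cpow ht.le]
  simp

theorem mellin_eq_gammaLogMoment (k : ℕ) (s : ℝ) :
    mellin (fun t : ℝ => ((log t ^ k * exp (-t) : ℝ) : ℂ)) s = (gammaLogMoment k s : ℂ) := by
  rw [mellin, gammaLogMoment, ← integral_complex_ofReal]
  exact setIntegral_congr_fun measurableSet_Ioi fun t ht => cpow_smul_log_pow_mul_exp_neg k s ht

theorem integrableOn_gammaLogMoment (k : ℕ) {s : ℝ} (hs : 0 < s) :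
    IntegrableOn (fun t : ℝ => t ^ (s - 1) * (log t ^ k * exp (-t))) (Set.Ioi 0) := by
  have h := (mellin_log_pow_mul_exp_neg k (s := (s : ℂ)) (by simpa using hs)).1
  have h' := IntegrableOn.congr_fun h
    (fun t ht => cpow_smul_log_pow_mul_exp_neg k s (Set.mem_Ioi.1 ht)) measurableSet_Ioi
  exact h'.re

theorem hasDerivAt_gammaLogMoment (k : ℕ) {s : ℝ} (hs : 0 < s) :
    HasDerivAt (gammaLogMoment k) (gammaLogMoment (k + 1) s) s := by
  have h := (mellin_log_pow_mul_exp_neg k (s := (s : ℂ)) (by simpa using hs)).2.real_of_complex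
  simpa only [mellin_eq_gammaLogMoment, Complex.ofReal_re] using h

theorem gammaLogMoment_zero {s : ℝ} (hs : 0 < s) : gammaLogMoment 0 s = Gamma s := by
  simp [gammaLogMoment, Gamma_eq_integral hs, mul_comm]

theorem hasDerivAt_Gamma_gammaLogMoment {s : ℝ} (hs : 0 < s) :
    HasDerivAt Gamma (gammaLogMoment 1 s) s := by
  refine (hasDerivAt_gammaLogMoment 0 hs).congr_of_eventuallyEq ?_
  filter_upwards [eventually_gt_nhds hs] with x hx using (gammaLogMoment_zero hx).symm

theorem hasDerivAt_deriv_Gamma_gammaLogMoment {s : ℝ} (hs : 0 < s) :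
    HasDerivAt (deriv Gamma) (gammaLogMoment 2 s) s := by
  refine (hasDerivAt_gammaLogMoment 1 hs).congr_of_eventuallyEq ?_
  filter_upwards [eventually_gt_nhds hs] with x hx
    using (hasDerivAt_Gamma_gammaLogMoment hx).deriv

/-- If `X` is chi-distributed with `r` degrees of freedom then `X ^ 2 / 2` is Gamma-distributed
with shape `r / 2`. -/
theorem integral_mul_chiPDF (r : ℝ) (F : ℝ → ℝ) :
    ∫ x in Set.Ioi (0 : ℝ), F x * chiPDF r x =
      ∫ t in Set.Ioi (0 : ℝ), F (√(2 * t)) * (t ^ (r / 2 - 1) * exp (-t) / Gamma (r / 2)) := by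
  have h1 := integral_comp_mul_left_Ioi
    (fun t => F (√(2 * t)) * (t ^ (r / 2 - 1) * exp (-t) / Gamma (r / 2))) 0
    (b := 1 / 2) (by norm_num)
  rw [mul_zero, ← integral_comp_rpow_Ioi_of_pos (p := 2) two_pos, eq_comm, smul_eq_mul,
    ← eq_inv_mul_iff_mul_eq₀ (by norm_num), ← integral_const_mul] at h1
  rw [h1]
  refine setIntegral_congr_fun measurableSet_Ioi fun x hx => ?_
  have hx : 0 < x := hx
  have e1 : 2 * (1 / 2 * x ^ 2) = x ^ 2 := by ring
  have e2 : (1 / 2 * x ^ 2) ^ (r / 2 - 1) = 2 ^ (1 - r / 2) * x ^ (r - 1) / x := by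
    rw [mul_rpow (by norm_num) (by positivity), one_div, inv_rpow two_pos.le,
      ← rpow_neg two_pos.le, ← rpow_natCast x 2, ← rpow_mul hx.le, mul_div_assoc,
      ← rpow_sub_one hx.ne']
    congr 2 <;> push_cast <;> ring
  have e3 : (2 : ℝ) - 1 = 1 := by norm_num
  simp only [rpow_two, e1, e2, e3, rpow_one, sqrt_sq hx.le, chiPDF, smul_eq_mul]
  rw [show -(1 / 2 * x ^ 2) = -x ^ 2 / 2 by ring]
  field_simp

theorem log_sqrt_two_mul_div_sqrt {r t : ℝ} (hr : 0 < r) (ht : 0 < t) :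
    log (√(2 * t) / √r) = 1 / 2 * (log t - log (r / 2)) := by
  rw [← sqrt_div (by positivity), log_sqrt (by positivity),
    show 2 * t / r = t / (r / 2) by field_simp, log_div ht.ne' (by positivity)]
  ring

theorem chiLogMean_eq {r : ℝ} (hr : 0 < r) :
    chiLogMean r = (1 / 2) * (deriv Gamma (r / 2) / Gamma (r / 2) - log (r / 2)) := by
  have hs : 0 < r / 2 := by positivity
  have hG := Gamma_pos_of_pos hs
  have h0 := integrableOn_gammaLogMoment 0 hs
  have h1 := integrableOn_gammaLogMoment 1 hs
  rw [chiLogMean, integral_mul_chiPDF r fun x => log (x / √r)]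
  calc
    _ = ∫ t in Set.Ioi (0 : ℝ), (2 * Gamma (r / 2))⁻¹ *
          (t ^ (r / 2 - 1) * (log t ^ 1 * exp (-t))
            - log (r / 2) * (t ^ (r / 2 - 1) * (log t ^ 0 * exp (-t)))) := by
      refine setIntegral_congr_fun measurableSet_Ioi fun t ht => ?_
      simp only [log_sqrt_two_mul_div_sqrt hr ht]
      field_simp
    _ = (2 * Gamma (r / 2))⁻¹ *
          (gammaLogMoment 1 (r / 2) - log (r / 2) * gammaLogMoment 0 (r / 2)) := by
      rw [integral_const_mul, integral_sub h1 (h0.const_mul _), integral_const_mul]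
      rfl
    _ = _ := by
      rw [gammaLogMoment_zero hs, (hasDerivAt_Gamma_gammaLogMoment hs).deriv]
      field_simp

theorem chiLogVar_eq {r : ℝ} (hr : 0 < r) :
    chiLogVar r = (1 / 4) * (Gamma (r / 2) * deriv (deriv Gamma) (r / 2)
      - (deriv Gamma (r / 2)) ^ 2) / (Gamma (r / 2)) ^ 2 := by
  have hs : 0 < r / 2 := by positivity
  have hG := Gamma_pos_of_pos hs
  have h0 := integrableOn_gammaLogMoment 0 hs
  have h1 := integrableOn_gammaLogMoment 1 hs
  have h2 := integrableOn_gammaLogMoment 2 hs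
  rw [chiLogVar, chiLogMean_eq hr, integral_mul_chiPDF r fun x => log (x / √r) ^ 2]
  have key : ∫ t in Set.Ioi (0 : ℝ), log (√(2 * t) / √r) ^ 2 *
      (t ^ (r / 2 - 1) * exp (-t) / Gamma (r / 2)) = (4 * Gamma (r / 2))⁻¹ *
          (gammaLogMoment 2 (r / 2) - 2 * log (r / 2) * gammaLogMoment 1 (r / 2)
            + log (r / 2) ^ 2 * gammaLogMoment 0 (r / 2)) := by
    calc
      _ = ∫ t in Set.Ioi (0 : ℝ), (4 * Gamma (r / 2))⁻¹ *
            (t ^ (r / 2 - 1) * (log t ^ 2 * exp (-t))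
              - 2 * log (r / 2) * (t ^ (r / 2 - 1) * (log t ^ 1 * exp (-t)))
              + log (r / 2) ^ 2 * (t ^ (r / 2 - 1) * (log t ^ 0 * exp (-t)))) := by
        refine setIntegral_congr_fun measurableSet_Ioi fun t ht => ?_
        simp only [log_sqrt_two_mul_div_sqrt hr ht]
        field_simp
        ring
      _ = _ := by
        rw [integral_const_mul, integral_add (by exact h2.sub (h1.const_mul _)) (h0.const_mul _),
          integral_sub h2 (h1.const_mul _), integral_const_mul, integral_const_mul]
        rfl
  rw [key, gammaLogMoment_zero hs, (hasDerivAt_Gamma_gammaLogMoment hs).deriv,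
    (hasDerivAt_deriv_Gamma_gammaLogMoment hs).deriv]
  field_simp
  ring

theorem Real.hasDerivAt_log_comp_Gamma {s : ℝ} (hs : 0 < s) :
    HasDerivAt (log ∘ Gamma) (logDeriv Gamma s) s :=
  (differentiableOn_Gamma_Ioi.differentiableAt (Ioi_mem_nhds hs)).hasDerivAt.log
    (Gamma_pos_of_pos hs).ne'

theorem Real.logDeriv_Gamma_add_one {s : ℝ} (hs : 0 < s) :
    logDeriv Gamma (s + 1) = logDeriv Gamma s + s⁻¹ := by
  have h1 := (hasDerivAt_log_comp_Gamma (s := s + 1) (by linarith)).comp_add_const s 1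
  have h2 := (hasDerivAt_log_comp_Gamma hs).add (hasDerivAt_log hs.ne')
  refine h1.unique (h2.congr_of_eventuallyEq ?_)
  filter_upwards [eventually_gt_nhds hs] with x hx
  simp [Gamma_add_one hx.ne', log_mul hx.ne' (Gamma_pos_of_pos hx).ne', add_comm]

theorem Real.logDeriv_Gamma_add_nat {s : ℝ} (hs : 0 < s) (n : ℕ) :
    logDeriv Gamma (s + n) = logDeriv Gamma s + ∑ m ∈ Finset.range n, (s + m)⁻¹ := by
  induction n with
  | zero => simp
  | succ n ih =>
    rw [Finset.sum_range_succ, ← add_assoc, ← ih, ← logDeriv_Gamma_add_one (by positivity)]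
    push_cast
    ring_nf

theorem Real.slope_log_comp_Gamma {s : ℝ} (hs : 0 < s) :
    slope (log ∘ Gamma) s (s + 1) = log s := by
  simp [slope_def_field, Gamma_add_one hs.ne', log_mul hs.ne' (Gamma_pos_of_pos hs).ne']

theorem Real.logDeriv_Gamma_le_log {s : ℝ} (hs : 0 < s) : logDeriv Gamma s ≤ log s :=
  slope_log_comp_Gamma hs ▸ convexOn_log_Gamma.le_slope_of_hasDerivAt hs
    (by positivity : 0 < s + 1) (lt_add_one s) (hasDerivAt_log_comp_Gamma hs)

theorem Real.log_sub_inv_le_logDeriv_Gamma {s : ℝ} (hs : 0 < s) :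
    log s - s⁻¹ ≤ logDeriv Gamma s := by
  have hs' : 0 < s + 1 := by positivity
  have := convexOn_log_Gamma.slope_le_of_hasDerivAt hs hs' (lt_add_one s)
    (hasDerivAt_log_comp_Gamma hs')
  rw [slope_log_comp_Gamma hs, logDeriv_Gamma_add_one hs] at this
  linarith

open Filter Topology in
theorem Real.tendsto_logDeriv_Gamma {s : ℝ} (hs : 0 < s) :
    Tendsto (fun n : ℕ => log n - ∑ m ∈ Finset.range n, (s + m)⁻¹) atTop
      (𝓝 (logDeriv Gamma s)) := by
  have hn : Tendsto (fun n : ℕ => s + n) atTop atTop :=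
    tendsto_atTop_add_const_left _ _ tendsto_natCast_atTop_atTop
  have h1 : Tendsto (fun n : ℕ => logDeriv Gamma (s + n) - log (s + n)) atTop (𝓝 0) := by
    have h := (tendsto_inv_atTop_zero.comp hn).neg
    rw [neg_zero] at h
    refine tendsto_of_tendsto_of_tendsto_of_le_of_le h tendsto_const_nhds (fun n => ?_) fun n => ?_
    · have := log_sub_inv_le_logDeriv_Gamma (s := s + n) (by positivity)
      simp only [Function.comp_apply]
      linarith
    · have := logDeriv_Gamma_le_log (s := s + n) (by positivity)
      simp only
      linarith
  have h2 : Tendsto (fun n : ℕ => log (s + n) - log n) atTop (𝓝 0) := by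
    have := (tendsto_log_comp_add_sub_log s).comp tendsto_natCast_atTop_atTop
    simpa [Function.comp_def, add_comm] using this
  have h3 := (tendsto_const_nhds (x := logDeriv Gamma s)).sub (h1.add h2)
  simp only [add_zero, sub_zero] at h3
  refine h3.congr fun n => ?_
  rw [logDeriv_Gamma_add_nat hs]
  ring

theorem Real.concaveOn_logDeriv_Gamma : ConcaveOn ℝ (Set.Ioi 0) (logDeriv Gamma) := by
  refine ⟨convex_Ioi 0, fun x hx y hy a b ha hb hab => ?_⟩
  have hx : 0 < x := hx
  have hy : 0 < y := hy
  have hz : 0 < a • x + b • y := convex_Ioi (0 : ℝ) hx hy ha hb hab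
  refine le_of_tendsto_of_tendsto' (((tendsto_logDeriv_Gamma hx).const_smul a).add
    ((tendsto_logDeriv_Gamma hy).const_smul b)) (tendsto_logDeriv_Gamma hz) fun n => ?_
  have key : ∑ m ∈ Finset.range n, (a • x + b • y + m)⁻¹ ≤
      a * ∑ m ∈ Finset.range n, (x + m)⁻¹ + b * ∑ m ∈ Finset.range n, (y + m)⁻¹ := by
    rw [Finset.mul_sum, Finset.mul_sum, ← Finset.sum_add_distrib]
    refine Finset.sum_le_sum fun m _ => ?_
    have h := (convexOn_zpow (𝕜 := ℝ) (-1)).2 (by positivity : 0 < x + m)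
      (by positivity : 0 < y + m) ha hb hab
    simp only [zpow_neg_one, smul_eq_mul] at h ⊢
    rwa [show a * (x + m) + b * (y + m) = a * x + b * y + m by
      linear_combination (m : ℝ) * hab] at h
  simp only [smul_eq_mul] at key ⊢
  linear_combination key + log n * hab

theorem Real.inv_le_of_hasDerivAt_logDeriv_Gamma {s d : ℝ} (hs : 0 < s)
    (hd : HasDerivAt (logDeriv Gamma) d s) : s⁻¹ ≤ d := by
  have := concaveOn_logDeriv_Gamma.slope_le_of_hasDerivAt hs (by positivity : 0 < s + 1)
    (lt_add_one s) hd
  simpa [slope_def_field, logDeriv_Gamma_add_one hs] using this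

theorem Real.le_of_hasDerivAt_logDeriv_Gamma {s d : ℝ} (hs : 0 < s)
    (hd : HasDerivAt (logDeriv Gamma) d s) : d ≤ s⁻¹ + (s ^ 2)⁻¹ := by
  have h1 : HasDerivAt (logDeriv Gamma) (d - (s ^ 2)⁻¹) (s + 1) := by
    have h := (hd.add (hasDerivAt_inv hs.ne')).congr_of_eventuallyEq
      (f₁ := fun x => logDeriv Gamma (x + 1)) (by
        filter_upwards [eventually_gt_nhds hs] with x hx using logDeriv_Gamma_add_one hx)
    have h' := HasDerivAt.comp_sub_const (s + 1) 1 (by simpa using h)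
    simpa [sub_eq_add_neg] using h'
  have := concaveOn_logDeriv_Gamma.le_slope_of_hasDerivAt hs (by positivity : 0 < s + 1)
    (lt_add_one s) h1
  simp [slope_def_field, logDeriv_Gamma_add_one hs] at this
  linarith

/-- The derivative of the logarithmic derivative of `Γ` in terms of `Γ` and its derivatives. -/
theorem hasDerivAt_logDeriv_Gamma {s : ℝ} (hs : 0 < s) :
    HasDerivAt (logDeriv Gamma)
      ((Gamma s * deriv (deriv Gamma) s - deriv Gamma s ^ 2) / Gamma s ^ 2) s := by
  have h1 := hasDerivAt_Gamma_gammaLogMoment hs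
  have h2 := hasDerivAt_deriv_Gamma_gammaLogMoment hs
  refine (h2.div h1 (Gamma_pos_of_pos hs).ne').congr_deriv ?_
  rw [h2.deriv, h1.deriv]
  ring

theorem abs_chiLogMean_le {r : ℝ} (hr : 0 < r) : |chiLogMean r| ≤ 1 / r := by
  have hs : 0 < r / 2 := by positivity
  have h1 := logDeriv_Gamma_le_log hs
  have h2 := log_sub_inv_le_logDeriv_Gamma hs
  have h3 : (r / 2)⁻¹ = 2 * (1 / r) := by field_simp
  have h4 : 0 < 1 / r := by positivity
  rw [chiLogMean_eq hr, ← logDeriv_apply, abs_le]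
  constructor <;> linarith

theorem abs_sqrt_chiLogVar_sub_le {r : ℝ} (hr : 0 < r) :
    |√(chiLogVar r) - 1 / √(2 * r)| ≤ r ^ (-(3 / 2) : ℝ) := by
  have hs : 0 < r / 2 := by positivity
  have hd := hasDerivAt_logDeriv_Gamma hs
  have h1 := inv_le_of_hasDerivAt_logDeriv_Gamma hs hd
  have h2 := le_of_hasDerivAt_logDeriv_Gamma hs hd
  rw [chiLogVar_eq hr, mul_div_assoc]
  set d := (Gamma (r / 2) * deriv (deriv Gamma) (r / 2) - deriv Gamma (r / 2) ^ 2) /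
    Gamma (r / 2) ^ 2
  have hp : r ^ (-(3 / 2) : ℝ) = (√r)⁻¹ ^ 3 := by
    rw [sqrt_eq_rpow, ← rpow_neg hr.le, ← rpow_natCast, ← rpow_mul hr.le]
    norm_num
  have hb : 1 / √(2 * r) = (√2)⁻¹ * (√r)⁻¹ := by
    rw [sqrt_mul two_pos.le, one_div, mul_inv]
  have hu : 0 < (√r)⁻¹ := by positivity
  have hu2 : r⁻¹ = (√r)⁻¹ ^ 2 := by rw [inv_pow, sq_sqrt hr.le]
  have hc : 0 < (√2)⁻¹ := by positivity
  have hc2 : (√2)⁻¹ ^ 2 = 1 / 2 := by rw [inv_pow, sq_sqrt two_pos.le, one_div]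
  have hc1 : 1 ≤ 2 * (√2)⁻¹ := by nlinarith
  rw [show (r / 2)⁻¹ = 2 * r⁻¹ by field_simp, hu2] at h1
  rw [show ((r / 2) ^ 2)⁻¹ = 4 * r⁻¹ ^ 2 by field_simp; norm_num,
    show (r / 2)⁻¹ = 2 * r⁻¹ by field_simp, hu2] at h2
  rw [hp, hb]
  generalize (√r)⁻¹ = u at *
  generalize (√2)⁻¹ = c at *
  have lower : c * u ≤ √(1 / 4 * d) := by
    refine le_sqrt_of_sq_le ?_
    rw [mul_pow, hc2]
    linarith
  have upper : √(1 / 4 * d) ≤ c * u + u ^ 3 := by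
    refine sqrt_le_iff.2 ⟨by positivity, ?_⟩
    have e : (c * u + u ^ 3) ^ 2 = 1 / 2 * u ^ 2 + 2 * c * u ^ 4 + u ^ 6 := by
      rw [← hc2]
      ring
    have h4 : u ^ 4 ≤ 2 * c * u ^ 4 := le_mul_of_one_le_left (by positivity) hc1
    have h6 : 0 < u ^ 6 := by positivity
    rw [e]
    linarith
  rw [abs_of_nonneg (by linarith)]
  linarith

/-- exact formulas for the mean and variance of `log(χ_r/√r)`,
and the asymptotics `E = O(1/r)` and `√Var = 1/√(2r) + O(r^{−3/2})` for `r ≥ 1`. -/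
theorem chi_log_mean_variance :
    (∀ r : ℝ, 0 < r →
      chiLogMean r = (1 / 2) * (deriv Real.Gamma (r / 2) / Real.Gamma (r / 2)
        - Real.log (r / 2))) ∧
    (∀ r : ℝ, 0 < r →
      chiLogVar r = (1 / 4) *
        (Real.Gamma (r / 2) * deriv (deriv Real.Gamma) (r / 2)
          - (deriv Real.Gamma (r / 2)) ^ 2) / (Real.Gamma (r / 2)) ^ 2) ∧
    (∃ C > (0 : ℝ), ∀ r : ℝ, 1 ≤ r →
      |chiLogMean r| ≤ C / r ∧
      |Real.sqrt (chiLogVar r) - 1 / Real.sqrt (2 * r)| ≤ C * r ^ (-(3 / 2) : ℝ)) := by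
  refine ⟨fun r hr => chiLogMean_eq hr, fun r hr => chiLogVar_eq hr, 1, one_pos, fun r hr => ?_⟩
  have hr : 0 < r := by linarith
  exact ⟨abs_chiLogMean_le hr, by simpa using abs_sqrt_chiLogVar_sub_le hr⟩

end
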